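/- Let g be a finite-dimensional semisimple Lie algebra over ℂ and let (h, e, f) be an sl₂ triple in g. For k ∈ ℂ let V_k = {x ∈ g : ⁅e,x⁆ = 0 and ⁅h,x⁆ = k • x} and W_k = {y ∈ g : ⁅f,y⁆ = 0 and ⁅h,y⁆ = (−k) • y}. Then the Killing form of g restricts to a nondegenerate pairing between V_k and W_k: for every nonzero x ∈ V_k there exists y ∈ W_k with κ(x,y) ≠ 0, and for every nonzero y ∈ W_k there exists x ∈ V_k with κ(x,y) ≠ 0. -/

import Mathlib

open Module in
/-- An endomorphism of a finite-dimensional space in characteristic zero which is an eigenvector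
of `ad H` with nonzero eigenvalue is nilpotent. -/
theorem Module.End.isNilpotent_of_commutator_eq_smul {K V : Type*} [Field K] [CharZero K]
    [AddCommGroup V] [Module K V] [FiniteDimensional K V] {H E : End K V} {a : K} (ha : a ≠ 0)
    (hE : H * E = E * H + a • E) : IsNilpotent E := by
  by_contra hn
  have hne (n : ℕ) : E ^ n ≠ 0 := fun h0 ↦ hn ⟨n, h0⟩
  have hpow (n : ℕ) : H * E ^ n = E ^ n * H + (n * a) • E ^ n := by
    induction n with
    | zero => simp
    | succ n ih =>
      rw [pow_succ, ← mul_assoc, ih, add_mul, mul_assoc, hE, mul_add, mul_assoc, smul_mul_assoc,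
        mul_smul_comm, add_assoc, ← add_smul]
      congr 2
      push_cast
      ring
  have hli := Module.End.eigenvectors_linearIndependent'
    (LinearMap.mulLeft K H - LinearMap.mulRight K H) (fun n : ℕ ↦ (n : K) * a)
    (fun m n hmn ↦ by simpa [ha] using hmn) (fun n ↦ E ^ n)
    (fun n ↦ ⟨by rw [Module.End.mem_eigenspace_iff]; simp [hpow n], hne n⟩)
  exact not_finite_iff_infinite.2 inferInstance hli.finite_of_isNoetherian

namespace Sl2Operators

open Module

variable {K V : Type*} [Field K] [AddCommGroup V] [Module K V] {E F H : End K V}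

theorem raise_lower_pow (hF : H * F = F * H - (2 : K) • F) (hEF : E * F = F * E + H)
    (j : ℕ) (v : V) :
    E ((F ^ (j + 1)) v) = (F ^ (j + 1)) (E v) + ((j : K) + 1) • (F ^ j) (H v - (j : K) • v) := by
  induction j generalizing v with
  | zero => simpa using LinearMap.congr_fun hEF v
  | succ j ih =>
    have h1 : E (F v) = F (E v) + H v := LinearMap.congr_fun hEF v
    have h2 : H (F v) = F (H v) - (2 : K) • F v := LinearMap.congr_fun hF v
    have h3 (i : ℕ) (w : V) : (F ^ (i + 1)) w = (F ^ i) (F w) := by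
      rw [pow_succ, End.mul_apply]
    rw [h3 (j + 1) v, ih, h1, h2, h3 (j + 1) (E v), h3 j (H v - _)]
    simp only [map_add, map_sub, map_smul, h3 j (H v), h3 j (F (E v))]
    push_cast
    module

theorem lower_raise_pow (hE : H * E = E * H + (2 : K) • E) (hEF : E * F = F * E + H)
    (j : ℕ) (v : V) :
    F ((E ^ (j + 1)) v) = (E ^ (j + 1)) (F v) - ((j : K) + 1) • (E ^ j) (H v + (j : K) • v) := by
  have h1 : -H * E = E * -H - (2 : K) • E := by rw [neg_mul, hE, mul_neg]; abel
  have h2 : F * E = E * F + -H := by rw [hEF]; abel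
  rw [raise_lower_pow h1 h2 j v]
  simp only [LinearMap.neg_apply, map_sub, map_add, map_neg, map_smul]
  module

theorem mapsTo_maxGenEigenspace_of_commutator_eq_smul {A : End K V} {a : K}
    (hA : H * A = A * H + a • A) (c : K) {v : V} (hv : v ∈ H.maxGenEigenspace c) :
    A v ∈ H.maxGenEigenspace (c + a) := by
  rw [End.mem_maxGenEigenspace] at hv ⊢
  obtain ⟨k, hk⟩ := hv
  have hs : SemiconjBy A (H - c • 1) (H - (c + a) • 1) := by
    simp only [SemiconjBy, mul_sub, sub_mul, hA, mul_smul_comm, smul_mul_assoc, mul_one, one_mul]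
    module
  exact ⟨k, by rw [← End.mul_apply, ← (hs.pow_right k).eq, End.mul_apply, hk, map_zero]⟩

/-- On the kernel of the lowering operator, generalized `H`-eigenvectors are eigenvectors. -/
theorem apply_eq_smul_of_lower_eq_zero [CharZero K] (hE : H * E = E * H + (2 : K) • E)
    (hF : H * F = F * H - (2 : K) • F) (hEF : E * F = F * E + H) (hnil : IsNilpotent E)
    {c : K} {y : V} (hy : y ∈ H.maxGenEigenspace c) (hFy : F y = 0) : H y = c • y := by
  have hFH {v : V} (hv : F v = 0) : F (H v) = 0 := by
    simpa [hv] using (LinearMap.congr_fun hF v).symm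
  rw [End.mem_maxGenEigenspace] at hy
  obtain ⟨k, hk⟩ := hy
  induction k generalizing y with
  | zero =>
    obtain rfl : y = 0 := by simpa using hk
    simp
  | succ k ih =>
    set w := H y - c • y with hw
    have hFw : F w = 0 := by simp [hw, hFH hFy, hFy]
    have hHw : H w = c • w := ih hFw (by simpa [pow_succ, hw] using hk)
    have hHy : H y = c • y + w := by rw [hw]; abel
    obtain ⟨N, hN⟩ := hnil
    have key (j : ℕ) (hj : j ≤ N) :
        (E ^ j) w = 0 ∧ ((E ^ j) y = 0 ∨ ∃ i ≥ j, c + (i : K) = 0) := by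
      induction hj using Nat.decreasingInduction with
      | self => simp [hN]
      | of_succ j hj ihj =>
        obtain ⟨hw1, hy1⟩ := ihj
        have hj0 : (j : K) + 1 ≠ 0 := Nat.cast_add_one_ne_zero j
        have ew := lower_raise_pow hE hEF j w
        rw [hw1, hFw, hHw, ← add_smul, map_smul, map_zero, map_zero, zero_sub, eq_comm, neg_eq_zero,
          smul_eq_zero_iff_right hj0, smul_eq_zero] at ew
        have ey (h0 : (E ^ (j + 1)) y = 0) : (c + (j : K)) • (E ^ j) y + (E ^ j) w = 0 := by
          have ey := lower_raise_pow hE hEF j y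
          rw [h0, hFy, hHy, map_zero, map_zero, zero_sub, eq_comm, neg_eq_zero,
            smul_eq_zero_iff_right hj0] at ey
          rw [← ey, ← map_smul, ← map_add]
          congr 1
          module
        by_cases hc : c + (j : K) = 0
        · refine ⟨?_, Or.inr ⟨j, le_rfl, hc⟩⟩
          rcases hy1 with h0 | ⟨i, hi, hci⟩
          · simpa [hc] using ey h0
          · have : i = j := by exact_mod_cast add_left_cancel (hci.trans hc.symm)
            omega
        · have hw0 := ew.resolve_left hc
          refine ⟨hw0, ?_⟩
          rcases hy1 with h0 | ⟨i, hi, hci⟩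
          · left
            simpa [hw0, hc] using ey h0
          · exact Or.inr ⟨i, by omega, hci⟩
    have : w = 0 := by simpa using (key 0 N.zero_le).1
    rwa [hw, sub_eq_zero] at this

/-- The operator `F * E` is injective on a generalized `H`-eigenspace whose eigenvalue is not a
natural number. -/
theorem eq_zero_of_lower_raise_eq_zero [CharZero K] (hE : H * E = E * H + (2 : K) • E)
    (hF : H * F = F * H - (2 : K) • F) (hEF : E * F = F * E + H) (hnil : IsNilpotent F)
    {c : K} (hc : ∀ j : ℕ, c ≠ j) {u : V} (hu : u ∈ H.maxGenEigenspace c)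
    (hFE : F (E u) = 0) : u = 0 := by
  rw [End.mem_maxGenEigenspace] at hu
  obtain ⟨k, hk⟩ := hu
  induction k generalizing u with
  | zero => simpa using hk
  | succ k ih =>
    have hFEH : F (E (H u)) = 0 := by
      have h1 : H (E u) = E (H u) + (2 : K) • E u := LinearMap.congr_fun hE u
      have h2 : H (F (E u)) = F (H (E u)) - (2 : K) • F (E u) := LinearMap.congr_fun hF (E u)
      simpa [h1, hFE] using h2.symm
    have hHu : H u = c • u := by
      rw [← sub_eq_zero]
      exact ih (by simp [hFEH, hFE]) (by simpa [pow_succ] using hk)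
    obtain ⟨N, hN⟩ := hnil
    have key (j : ℕ) (hj : j ≤ N) : (F ^ j) u = 0 := by
      induction hj using Nat.decreasingInduction with
      | self => simp [hN]
      | of_succ j hj ihj =>
        have h0 := raise_lower_pow hF hEF j u
        rw [ihj, pow_succ, End.mul_apply, hFE, hHu, ← sub_smul, map_smul, map_zero, map_zero,
          zero_add, eq_comm, smul_eq_zero_iff_right (Nat.cast_add_one_ne_zero j),
          smul_eq_zero_iff_right (sub_ne_zero.2 (hc j))] at h0
        exact h0
    simpa using key 0 N.zero_le

/-- A nonzero linear functional which vanishes on the range of the raising operator and has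
`H`-weight `c` does not vanish on all lowest weight vectors of weight `c`. -/
theorem exists_lowest_weight_apply_ne_zero [CharZero K] [IsAlgClosed K] [FiniteDimensional K V]
    (hE : H * E = E * H + (2 : K) • E) (hF : H * F = F * H - (2 : K) • F)
    (hEF : E * F = F * E + H) {c : K} (hc : ∀ j : ℕ, c - 2 ≠ j) {φ : V →ₗ[K] K} (hφ : φ ≠ 0)
    (hφE : ∀ v, φ (E v) = 0) (hφH : ∀ v, φ (H v) = c * φ v) :
    ∃ y, F y = 0 ∧ H y = c • y ∧ φ y ≠ 0 := by
  have hF' : H * F = F * H + (-2 : K) • F := by rw [hF, neg_smul, sub_eq_add_neg]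
  have hEnil : IsNilpotent E := End.isNilpotent_of_commutator_eq_smul two_ne_zero hE
  have hFnil : IsNilpotent F :=
    End.isNilpotent_of_commutator_eq_smul (neg_ne_zero.2 two_ne_zero) hF'
  obtain ⟨z, hz, hφz⟩ : ∃ z ∈ H.maxGenEigenspace c, φ z ≠ 0 := by
    by_contra! hcon
    refine hφ (LinearMap.ker_eq_top.1 (top_le_iff.1 ?_))
    rw [← End.iSup_maxGenEigenspace_eq_top H]
    refine iSup_le fun d v hv ↦ LinearMap.mem_ker.2 ?_
    by_cases hd : d = c
    · exact hcon v (hd ▸ hv)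
    obtain ⟨k, hk⟩ := (End.mem_maxGenEigenspace H d v).1 hv
    have hpow (k : ℕ) (v : V) : φ (((H - d • 1) ^ k) v) = (c - d) ^ k * φ v := by
      induction k generalizing v with
      | zero => simp
      | succ k ih =>
        rw [pow_succ, End.mul_apply, ih]
        simp [hφH]
        ring
    have := hpow k v
    rw [hk, map_zero, eq_comm, mul_eq_zero] at this
    exact this.resolve_left (pow_ne_zero _ (sub_ne_zero.2 (Ne.symm hd)))
  have hEmem {v : V} (hv : v ∈ H.maxGenEigenspace (c - 2)) : E v ∈ H.maxGenEigenspace c := by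
    simpa using mapsTo_maxGenEigenspace_of_commutator_eq_smul hE _ hv
  have hFmem {v : V} (hv : v ∈ H.maxGenEigenspace c) : F v ∈ H.maxGenEigenspace (c - 2) := by
    simpa [sub_eq_add_neg] using mapsTo_maxGenEigenspace_of_commutator_eq_smul hF' _ hv
  let T : End K (H.maxGenEigenspace (c - 2)) := (F * E).restrict fun v hv ↦ hFmem (hEmem hv)
  have hT : Function.Surjective T := by
    refine LinearMap.injective_iff_surjective.1 ((injective_iff_map_eq_zero T).2 fun u hu ↦ ?_)
    exact Subtype.ext (eq_zero_of_lower_raise_eq_zero hE hF hEF hFnil hc u.2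
      (congrArg Subtype.val hu))
  obtain ⟨u, hu⟩ := hT ⟨F z, hFmem hz⟩
  have hFu : F (E u) = F z := congrArg Subtype.val hu
  have hFy : F (z - E u) = 0 := by rw [map_sub, hFu, sub_self]
  refine ⟨z - E u, hFy, ?_, by rwa [map_sub, hφE, sub_zero]⟩
  exact apply_eq_smul_of_lower_eq_zero hE hF hEF hEnil (Submodule.sub_mem _ hz (hEmem u.2)) hFy

end Sl2Operators

theorem exists_lowest_weight_killingForm_ne_zero {L : Type*} [LieRing L] [LieAlgebra ℂ L]
    [FiniteDimensional ℂ L] [LieAlgebra.IsKilling ℂ L] {h e f : L}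
    (hhe : ⁅h, e⁆ = (2 : ℂ) • e) (hhf : ⁅h, f⁆ = (-2 : ℂ) • f) (hef : ⁅e, f⁆ = h)
    {k : ℂ} {x : L} (hx : x ≠ 0) (hex : ⁅e, x⁆ = 0) (hhx : ⁅h, x⁆ = k • x) :
    ∃ y : L, ⁅f, y⁆ = 0 ∧ ⁅h, y⁆ = (-k) • y ∧ killingForm ℂ L x y ≠ 0 := by
  obtain ⟨n, rfl⟩ : ∃ n : ℕ, k = n := by
    by_cases h0 : h = 0
    · refine ⟨0, ?_⟩
      simpa [h0, hx, eq_comm] using hhx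
    · have t : IsSl2Triple h e f :=
        ⟨h0, hef, by rw [hhe, ofNat_smul_eq_nsmul], by rw [hhf, neg_smul, ofNat_smul_eq_nsmul]⟩
      exact (IsSl2Triple.HasPrimitiveVectorWith.mk (t := t) hx hhx hex).exists_nat
  have hinv (a v : L) : killingForm ℂ L x ⁅a, v⁆ = -killingForm ℂ L ⁅a, x⁆ v := by
    rw [← LieModule.traceForm_apply_lie_apply, ← lie_skew, map_neg, LinearMap.neg_apply]
  refine Sl2Operators.exists_lowest_weight_apply_ne_zero (E := LieAlgebra.ad ℂ L e)
    (F := LieAlgebra.ad ℂ L f) (H := LieAlgebra.ad ℂ L h) (φ := killingForm ℂ L x)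
    ?_ ?_ ?_ ?_ ?_ ?_ ?_
  · ext v
    simp [leibniz_lie h e v, hhe, add_comm]
  · ext v
    simp [leibniz_lie h f v, hhf, sub_eq_add_neg, add_comm]
  · ext v
    simp [leibniz_lie e f v, hef, add_comm]
  · intro j hj
    have : ((n + 2 + j : ℕ) : ℂ) = 0 := by
      push_cast
      rw [← hj]
      ring
    have := Nat.cast_eq_zero.1 this
    omega
  · intro h0
    have : x ∈ LinearMap.ker (killingForm ℂ L) := h0
    rw [LieAlgebra.IsKilling.ker_killingForm_eq_bot] at this
    exact hx (by simpa using this)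
  · intro v
    rw [LieAlgebra.ad_apply, hinv, hex, map_zero, LinearMap.zero_apply, neg_zero]
  · intro v
    rw [LieAlgebra.ad_apply, hinv, hhx, map_smul, LinearMap.smul_apply, smul_eq_mul, neg_mul]

/-- The Killing form restricts to a nondegenerate pairing between the space `V_k` of highest
weight vectors of `ad h`-weight `k` and the space `W_k` of lowest weight vectors of
`ad h`-weight `-k`, for any `sl₂` triple `(h,e,f)` in a finite-dimensional complex
semisimple Lie algebra. -/
theorem killingForm_nondegenerate_pairing_hw_lw
    (L : Type*) [LieRing L] [LieAlgebra ℂ L] [FiniteDimensional ℂ L]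
    [LieAlgebra.IsSemisimple ℂ L]
    (h e f : L)
    (hhe : ⁅h, e⁆ = (2 : ℂ) • e) (hhf : ⁅h, f⁆ = (-2 : ℂ) • f) (hef : ⁅e, f⁆ = h)
    (k : ℂ) :
    (∀ x : L, x ≠ 0 → ⁅e, x⁆ = 0 → ⁅h, x⁆ = k • x →
        ∃ y : L, ⁅f, y⁆ = 0 ∧ ⁅h, y⁆ = (-k) • y ∧ killingForm ℂ L x y ≠ 0) ∧
    (∀ y : L, y ≠ 0 → ⁅f, y⁆ = 0 → ⁅h, y⁆ = (-k) • y →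
        ∃ x : L, ⁅e, x⁆ = 0 ∧ ⁅h, x⁆ = k • x ∧ killingForm ℂ L x y ≠ 0) := by
  refine ⟨fun x hx hex hhx ↦ exists_lowest_weight_killingForm_ne_zero hhe hhf hef hx hex hhx,
    fun y hy hfy hhy ↦ ?_⟩
  obtain ⟨x, hex, hhx, hxy⟩ := exists_lowest_weight_killingForm_ne_zero (h := -h) (e := f) (f := e)
    (k := k) (by rw [neg_lie, hhf, neg_smul, neg_neg]) (by rw [neg_lie, hhe, neg_smul])
    (by rw [← lie_skew, hef]) hy hfy (by rw [neg_lie, hhy, neg_smul, neg_neg])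
  refine ⟨x, hex, ?_, by rwa [LieModule.traceForm_comm]⟩
  rwa [neg_lie, neg_smul, neg_inj] at hhx
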